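/- For every fixed integer d ≥ 1 there is a constant C_d such that for every d-dimensional torus graph G on n vertices (the Cartesian product of d cycles of length n^{1/d}, with n^{1/d} an integer ≥ 3), the deterministic edge cover time satisfies ẼC(G) ≤ C_d·κ̃·n^{1+1/d}. -/

import Mathlib

/-- A rotor configuration on `G`: each vertex `u` carries a rotor sequence of length `d u`
(encoded as a `(d u)`-periodic map `s u : ℕ → V`) consisting of neighbors of `u`, in which
every neighbor of `u` occurs exactly `d u / deg u` times, together with an initial rotor
position `r0 u`. -/
structure RotorConfig {V : Type*} [Fintype V] [DecidableEq V]
    (G : SimpleGraph V) [DecidableRel G.Adj] where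
  d : V → ℕ
  d_pos : ∀ u, 0 < d u
  s : V → ℕ → V
  periodic : ∀ u i, s u (i + d u) = s u i
  adj : ∀ u i, i < d u → G.Adj u (s u i)
  count : ∀ u v, G.Adj u v →
    ((Finset.range (d u)).filter (fun i => s u i = v)).card = d u / G.degree u
  r0 : V → ℕ

namespace RotorConfig

variable {V : Type*} [Fintype V] [DecidableEq V] {G : SimpleGraph V} [DecidableRel G.Adj]

/-- `κ̃ = max_u d̃(u)/deg(u)`. -/
def kappa (cfg : RotorConfig G) : ℕ :=
  Finset.univ.sup fun u => cfg.d u / G.degree u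

/-- One step of the rotor walk; a state is a pair (current vertex, rotor positions). -/
def step (cfg : RotorConfig G) (st : V × (V → ℕ)) : V × (V → ℕ) :=
  (cfg.s st.1 (st.2 st.1), Function.update st.2 st.1 (st.2 st.1 + 1))

/-- The state of the rotor walk started at `x0` after `t` steps. -/
def state (cfg : RotorConfig G) (x0 : V) : ℕ → V × (V → ℕ)
  | 0 => (x0, cfg.r0)
  | t + 1 => cfg.step (state cfg x0 t)

/-- The position of the rotor walk started at `x0` after `t` steps. -/
def pos (cfg : RotorConfig G) (x0 : V) (t : ℕ) : V := (cfg.state x0 t).1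

/-- Every edge of `G` is traversed (in some direction) within the first `t` steps of the
rotor walk started at `x0`. -/
def coversEdges (cfg : RotorConfig G) (x0 : V) (t : ℕ) : Prop :=
  ∀ u v : V, G.Adj u v → ∃ ℓ, 1 ≤ ℓ ∧ ℓ ≤ t ∧
    ((cfg.pos x0 (ℓ - 1) = u ∧ cfg.pos x0 ℓ = v) ∨
     (cfg.pos x0 (ℓ - 1) = v ∧ cfg.pos x0 ℓ = u))

end RotorConfig

/-- Two vertices of the `d`-dimensional torus `(ℤ/Nℤ)^d` are adjacent iff they differ by
`±1 (mod N)` in exactly one coordinate. -/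
def TorusAdj (d N : ℕ) (x y : Fin d → ZMod N) : Prop :=
  ∃ i : Fin d, (x i = y i + 1 ∨ x i = y i - 1) ∧ ∀ j : Fin d, j ≠ i → x j = y j


namespace RotorConfig

variable {V : Type*} [Fintype V] [DecidableEq V] {G : SimpleGraph V} [DecidableRel G.Adj]

/-- rotor position of `u` at time `t` -/
def rot (cfg : RotorConfig G) (x0 : V) (t : ℕ) (u : V) : ℕ := (cfg.state x0 t).2 u

lemma rot_zero (cfg : RotorConfig G) (x0 : V) (u : V) : cfg.rot x0 0 u = cfg.r0 u := rfl

lemma pos_succ (cfg : RotorConfig G) (x0 : V) (t : ℕ) :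
    cfg.pos x0 (t + 1) = cfg.s (cfg.pos x0 t) (cfg.rot x0 t (cfg.pos x0 t)) := rfl

lemma rot_succ (cfg : RotorConfig G) (x0 : V) (t : ℕ) (u : V) :
    cfg.rot x0 (t + 1) u = if u = cfg.pos x0 t then cfg.rot x0 t u + 1 else cfg.rot x0 t u := by
  change Function.update (cfg.state x0 t).2 (cfg.state x0 t).1 _ u = _
  rw [Function.update_apply]
  split_ifs with h1 h2 h2
  · subst h1; rfl
  · exact absurd h1 h2
  · exact absurd h2 h1
  · rfl

lemma r0_le_rot (cfg : RotorConfig G) (x0 : V) (t : ℕ) (u : V) : cfg.r0 u ≤ cfg.rot x0 t u := by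
  induction t with
  | zero => exact le_rfl
  | succ t ih => rw [rot_succ]; split_ifs <;> omega

lemma sum_along (cfg : RotorConfig G) (x0 : V) (f : V → ℕ → ℝ) (t : ℕ) :
    ∑ l ∈ Finset.range t, f (cfg.pos x0 l) (cfg.rot x0 l (cfg.pos x0 l))
      = ∑ u, ∑ i ∈ Finset.Ico (cfg.r0 u) (cfg.rot x0 t u), f u i := by
  induction t with
  | zero => simp [rot_zero]
  | succ t ih =>
    rw [Finset.sum_range_succ, ih]
    have : ∀ u, ∑ i ∈ Finset.Ico (cfg.r0 u) (cfg.rot x0 (t+1) u), f u i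
        = ∑ i ∈ Finset.Ico (cfg.r0 u) (cfg.rot x0 t u), f u i
          + if u = cfg.pos x0 t then f u (cfg.rot x0 t u) else 0 := by
      intro u
      rw [rot_succ]
      split_ifs with h
      · rw [Finset.sum_Ico_succ_top (cfg.r0_le_rot x0 t u)]
      · simp
    simp_rw [this]
    rw [Finset.sum_add_distrib]
    simp

lemma exists_visit (cfg : RotorConfig G) (x0 : V) (w : V) (t i : ℕ) (h1 : cfg.r0 w ≤ i)
    (h2 : i < cfg.rot x0 t w) : ∃ l < t, cfg.pos x0 l = w ∧ cfg.rot x0 l w = i := by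
  induction t with
  | zero => rw [rot_zero] at h2; omega
  | succ t ih =>
    by_cases h : i < cfg.rot x0 t w
    · obtain ⟨l, hl, h3⟩ := ih h
      exact ⟨l, by omega, h3⟩
    · rw [rot_succ] at h2
      split_ifs at h2 with h3
      · exact ⟨t, by omega, h3.symm, by omega⟩
      · omega

lemma s_mul (cfg : RotorConfig G) (u : V) (i k : ℕ) : cfg.s u (i + k * cfg.d u) = cfg.s u i := by
  induction k with
  | zero => simp
  | succ k ih => rw [Nat.succ_mul, ← Nat.add_assoc, cfg.periodic, ih]

lemma s_mod (cfg : RotorConfig G) (u : V) (i : ℕ) : cfg.s u (i % cfg.d u) = cfg.s u i := by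
  conv_rhs => rw [← Nat.mod_add_div i (cfg.d u), mul_comm, s_mul]

lemma sum_period (cfg : RotorConfig G) (u : V) (g : V → ℝ) :
    ∑ i ∈ Finset.range (cfg.d u), g (cfg.s u i)
      = ((cfg.d u / G.degree u : ℕ) : ℝ) * ∑ v ∈ G.neighborFinset u, g v := by
  have hm : ∀ i ∈ Finset.range (cfg.d u), cfg.s u i ∈ G.neighborFinset u := by
    intro i hi
    rw [SimpleGraph.mem_neighborFinset]
    exact cfg.adj u i (Finset.mem_range.1 hi)
  rw [← Finset.sum_fiberwise_of_maps_to hm, Finset.mul_sum]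
  refine Finset.sum_congr rfl fun v hv => ?_
  rw [SimpleGraph.mem_neighborFinset] at hv
  rw [← cfg.count u v hv]
  rw [Finset.sum_congr rfl (g := fun _ => g v)]
  · simp
  · intro i hi
    rw [(Finset.mem_filter.1 hi).2]

lemma d_eq (cfg : RotorConfig G) (u : V) :
    (cfg.d u : ℝ) = ((cfg.d u / G.degree u : ℕ) : ℝ) * (G.degree u : ℝ) := by
  have := cfg.sum_period u (fun _ => 1)
  simpa using this

lemma quot_le (cfg : RotorConfig G) (u : V) : cfg.d u / G.degree u ≤ cfg.kappa :=
  Finset.le_sup (f := fun u => cfg.d u / G.degree u) (Finset.mem_univ u)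

lemma quot_pos (cfg : RotorConfig G) (u : V) : 0 < cfg.d u / G.degree u := by
  rcases Nat.eq_zero_or_pos (cfg.d u / G.degree u) with h | h
  · have := cfg.d_eq u
    rw [h] at this
    have h2 := cfg.d_pos u
    simp at this
    omega
  · exact h

end RotorConfig

lemma sum_shift_periodic (f : ℕ → ℝ) (d : ℕ) (hf : ∀ i, f (i + d) = f i) (r : ℕ) :
    ∑ k ∈ Finset.range d, f (r + k) = ∑ k ∈ Finset.range d, f k := by
  induction r with
  | zero => simp
  | succ r ih =>
    rw [← ih]
    have h1 := Finset.sum_range_succ (fun k => f (r + k)) d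
    have h2 := Finset.sum_range_succ' (fun k => f (r + k)) d
    rw [h1, hf] at h2
    have h3 : ∑ k ∈ Finset.range d, f (r + 1 + k) = ∑ k ∈ Finset.range d, f (r + (k + 1)) :=
      Finset.sum_congr rfl fun k _ => by ring_nf
    rw [h3]
    simp at h2
    linarith

lemma sum_window_le (f : ℕ → ℝ) (d : ℕ) (hd : 0 < d) (hf : ∀ i, f (i + d) = f i)
    (hS : ∑ k ∈ Finset.range d, f k ≤ -(d : ℝ)) (X : ℕ) :
    ∀ r, ∑ k ∈ Finset.range X, f (r + k)
      ≤ -(X : ℝ) + d + ∑ k ∈ Finset.range d, |f k| := by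
  induction X using Nat.strong_induction_on with
  | _ X ih =>
    intro r
    by_cases h : X < d
    · have h1 : ∑ k ∈ Finset.range X, f (r + k) ≤ ∑ k ∈ Finset.range X, |f (r + k)| :=
        Finset.sum_le_sum fun _ _ => le_abs_self _
      have h2 : ∑ k ∈ Finset.range X, |f (r + k)| ≤ ∑ k ∈ Finset.range d, |f (r + k)| :=
        Finset.sum_le_sum_of_subset_of_nonneg (Finset.range_mono h.le) fun _ _ _ => abs_nonneg _
      have h3 := sum_shift_periodic (fun i => |f i|) d (fun i => by simp [hf]) r
      have h4 : (X : ℝ) ≤ d := by exact_mod_cast h.le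
      linarith
    · push Not at h
      obtain ⟨Y, rfl⟩ := Nat.exists_eq_add_of_le h
      rw [Finset.sum_range_add]
      have h1 := sum_shift_periodic f d hf r
      have h2 := ih Y (by omega) (r + d)
      have h3 : ∑ k ∈ Finset.range Y, f (r + (d + k)) = ∑ k ∈ Finset.range Y, f (r + d + k) :=
        Finset.sum_congr rfl fun k _ => by ring_nf
      rw [h3, h1]
      push_cast
      linarith

namespace RotorConfig

variable {V : Type*} [Fintype V] [DecidableEq V] {G : SimpleGraph V} [DecidableRel G.Adj]

lemma time_le (cfg : RotorConfig G) (x0 w : V) (h : V → ℝ) (t : ℕ)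
    (hdrift : ∀ u, u ≠ w → ∑ v ∈ G.neighborFinset u, (h v - h u) ≤ -(G.degree u : ℝ))
    (hw : cfg.rot x0 t w - cfg.r0 w < cfg.d w) :
    (t : ℝ) ≤ (cfg.kappa : ℝ) * (∑ u, (G.degree u : ℝ))
      + (cfg.kappa : ℝ) * (∑ u, ∑ v ∈ G.neighborFinset u, |h v - h u|)
      + (h x0 - h (cfg.pos x0 t)) := by
  have ht : (t : ℝ) = ∑ u, ((cfg.rot x0 t u - cfg.r0 u : ℕ) : ℝ) := by
    have := cfg.sum_along x0 (fun _ _ => 1) t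
    simpa using this
  have htel : h (cfg.pos x0 t) - h x0
      = ∑ u, ∑ i ∈ Finset.Ico (cfg.r0 u) (cfg.rot x0 t u), (h (cfg.s u i) - h u) := by
    rw [← cfg.sum_along x0 (fun u i => h (cfg.s u i) - h u) t]
    simp_rw [← pos_succ]
    rw [Finset.sum_range_sub (fun l => h (cfg.pos x0 l))]
    rfl
  have key : ∀ u, ∑ i ∈ Finset.Ico (cfg.r0 u) (cfg.rot x0 t u), (h (cfg.s u i) - h u)
      ≤ -((cfg.rot x0 t u - cfg.r0 u : ℕ) : ℝ) + (cfg.kappa : ℝ) * (G.degree u : ℝ)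
        + (cfg.kappa : ℝ) * ∑ v ∈ G.neighborFinset u, |h v - h u| := by
    intro u
    rw [Finset.sum_Ico_eq_sum_range]
    have hper : ∀ i, (fun i => h (cfg.s u i) - h u) (i + cfg.d u)
        = (fun i => h (cfg.s u i) - h u) i := by
      intro i; simp [cfg.periodic]
    have hA := cfg.sum_period u (fun v => |h v - h u|)
    have hS := cfg.sum_period u (fun v => h v - h u)
    have hq : ((cfg.d u / G.degree u : ℕ) : ℝ) ≤ cfg.kappa := by exact_mod_cast cfg.quot_le u
    have hq0 : (0 : ℝ) ≤ ((cfg.d u / G.degree u : ℕ) : ℝ) := Nat.cast_nonneg _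
    have hA2 : ((cfg.d u / G.degree u : ℕ) : ℝ) * ∑ v ∈ G.neighborFinset u, |h v - h u|
        ≤ (cfg.kappa : ℝ) * ∑ v ∈ G.neighborFinset u, |h v - h u| :=
      mul_le_mul_of_nonneg_right hq (Finset.sum_nonneg fun _ _ => abs_nonneg _)
    have hd2 : (cfg.d u : ℝ) ≤ (cfg.kappa : ℝ) * (G.degree u : ℝ) := by
      rw [cfg.d_eq u]; exact mul_le_mul_of_nonneg_right hq (Nat.cast_nonneg _)
    by_cases huw : u = w
    · subst huw
      have h1 : ∑ k ∈ Finset.range (cfg.rot x0 t u - cfg.r0 u),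
          (h (cfg.s u (cfg.r0 u + k)) - h u)
          ≤ ∑ k ∈ Finset.range (cfg.rot x0 t u - cfg.r0 u),
            |h (cfg.s u (cfg.r0 u + k)) - h u| :=
        Finset.sum_le_sum fun _ _ => le_abs_self _
      have h2 : ∑ k ∈ Finset.range (cfg.rot x0 t u - cfg.r0 u),
            |h (cfg.s u (cfg.r0 u + k)) - h u| ≤ ∑ k ∈ Finset.range (cfg.d u),
            |h (cfg.s u (cfg.r0 u + k)) - h u| :=
        Finset.sum_le_sum_of_subset_of_nonneg (Finset.range_mono hw.le) fun _ _ _ => abs_nonneg _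
      have h3 := sum_shift_periodic (fun i => |h (cfg.s u i) - h u|) (cfg.d u)
        (fun i => by simp [cfg.periodic]) (cfg.r0 u)
      have h4 : ((cfg.rot x0 t u - cfg.r0 u : ℕ) : ℝ) ≤ cfg.d u := by exact_mod_cast hw.le
      linarith
    · have h5 := sum_window_le (fun i => h (cfg.s u i) - h u) (cfg.d u) (cfg.d_pos u) hper
        (by
          rw [hS]
          have := mul_le_mul_of_nonneg_left (hdrift u huw) hq0
          have h6 := cfg.d_eq u
          linarith) (cfg.rot x0 t u - cfg.r0 u) (cfg.r0 u)
      linarith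
  have := Finset.sum_le_sum fun u (_ : u ∈ Finset.univ) => key u
  rw [← htel, Finset.sum_add_distrib, Finset.sum_add_distrib, Finset.sum_neg_distrib, ← ht,
    ← Finset.mul_sum, ← Finset.mul_sum] at this
  linarith

lemma covers_of_visits (cfg : RotorConfig G) (x0 : V) (t : ℕ)
    (hw : ∀ w, cfg.d w ≤ cfg.rot x0 t w - cfg.r0 w) : cfg.coversEdges x0 t := by
  intro u v huv
  have h1 := cfg.count u v huv
  have h2 := cfg.quot_pos u
  rw [← h1, Finset.card_pos] at h2
  obtain ⟨i, hi⟩ := h2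
  rw [Finset.mem_filter, Finset.mem_range] at hi
  obtain ⟨hi, his⟩ := hi
  -- find j in window with j % d = i
  have hd := cfg.d_pos u
  obtain ⟨j, hj1, hj2, hj3⟩ : ∃ j, cfg.r0 u ≤ j ∧ j < cfg.r0 u + cfg.d u ∧ j % cfg.d u = i := by
    have hr := Nat.mod_add_div (cfg.r0 u) (cfg.d u)
    have hm := Nat.mod_lt (cfg.r0 u) hd
    by_cases hlt : cfg.r0 u % cfg.d u ≤ i
    · refine ⟨i + cfg.d u * (cfg.r0 u / cfg.d u), by omega, by omega, ?_⟩
      rw [Nat.add_mul_mod_self_left, Nat.mod_eq_of_lt hi]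
    · refine ⟨i + cfg.d u * (cfg.r0 u / cfg.d u + 1), ?_, ?_, ?_⟩
      · rw [Nat.mul_succ]; omega
      · rw [Nat.mul_succ]; omega
      · rw [Nat.add_mul_mod_self_left, Nat.mod_eq_of_lt hi]
  have h3 := hw u
  have h4 := cfg.r0_le_rot x0 t u
  obtain ⟨l, hl, hlp, hlr⟩ := cfg.exists_visit x0 u t j hj1 (by omega)
  refine ⟨l + 1, by omega, by omega, Or.inl ⟨by simpa using hlp, ?_⟩⟩
  rw [pos_succ, hlp, hlr, ← s_mod, hj3, his]

end RotorConfig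

section Analysis

/-- Radial profile with derivative `q ^ (-(b+1))`. -/
noncomputable def radF (b q : ℝ) : ℝ := -(q ^ (-b)) / b

lemma radF_hasDerivAt {b q : ℝ} (hb : b ≠ 0) (hq : 0 < q) :
    HasDerivAt (radF b) (q ^ (-(b + 1))) q := by
  have h := (Real.hasDerivAt_rpow_const (p := -b) (Or.inl hq.ne')).neg.div_const b
  have e : -(-b * q ^ (-b - 1)) / b = q ^ (-(b + 1)) := by
    rw [show -(b + 1) = -b - 1 by ring]; field_simp
  rw [e] at h
  exact h

lemma radF_sub_le {b x y : ℝ} (hb : b ≠ 0) (hb1 : 0 ≤ b + 1) (hx : 0 < x) (hxy : x ≤ y) :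
    radF b y - radF b x ≤ x ^ (-(b + 1)) * (y - x) := by
  refine Convex.image_sub_le_mul_sub_of_deriv_le (convex_Ici x) ?_ ?_ ?_ x
    (Set.mem_Ici.2 le_rfl) y (Set.mem_Ici.2 hxy) hxy
  · intro z hz
    exact (radF_hasDerivAt hb (lt_of_lt_of_le hx hz)).continuousAt.continuousWithinAt
  · intro z hz
    rw [interior_Ici] at hz
    exact (radF_hasDerivAt hb (hx.trans hz)).differentiableAt.differentiableWithinAt
  · intro z hz
    rw [interior_Ici] at hz
    rw [(radF_hasDerivAt hb (hx.trans hz)).deriv]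
    exact Real.rpow_le_rpow_of_nonpos hx (le_of_lt hz) (by linarith)

lemma radF_mono {b x y : ℝ} (hx : 0 < x) (hxy : x ≤ y) (hb : b ≠ 0) :
    radF b x ≤ radF b y := by
  unfold radF
  rcases lt_or_gt_of_ne hb with h | h
  · rw [div_le_div_right_of_neg h, neg_le_neg_iff]
    exact Real.rpow_le_rpow hx.le hxy (by linarith)
  · rw [div_le_div_iff_of_pos_right h, neg_le_neg_iff]
    exact Real.rpow_le_rpow_of_nonpos hx hxy (by linarith)

lemma radF_scale {b q y : ℝ} (hq : 0 < q) (hy : 0 < 1 + y) :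
    radF b (q * (1 + y)) - radF b q = q ^ (-b) * (radF b (1 + y) - radF b 1) := by
  unfold radF
  rw [Real.mul_rpow hq.le hy.le, Real.one_rpow]
  ring

lemma radF_quadratic {b c : ℝ} (hb : b ≠ 0) (hc : 2 * c < b + 1) :
    ∃ δ : ℝ, 0 < δ ∧ δ < 1 ∧ ∀ y, |y| < δ → radF b (1 + y) - radF b 1 ≤ y - c * y ^ 2 := by
  let f : ℝ → ℝ := fun y => y - c * y ^ 2 - radF b (1 + y)
  have hd : ∀ y : ℝ, -1 < y → HasDerivAt f (1 - 2 * c * y - (1 + y) ^ (-(b + 1))) y := by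
    intro y hy
    have h1 : HasDerivAt (fun y : ℝ => radF b (1 + y)) ((1 + y) ^ (-(b + 1))) y := by
      have := radF_hasDerivAt (q := 1 + y) hb (by linarith)
      exact HasDerivAt.comp_const_add 1 y this
    have h2 : HasDerivAt (fun y : ℝ => y - c * y ^ 2) (1 - 2 * c * y) y := by
      have := (hasDerivAt_id y).sub ((hasDerivAt_pow 2 y).const_mul c)
      refine this.congr_deriv ?_
      simp; ring
    exact h2.sub h1
  have he : deriv f =ᶠ[nhds 0] fun y => 1 - 2 * c * y - (1 + y) ^ (-(b + 1)) := by
    filter_upwards [lt_mem_nhds (show (-1 : ℝ) < 0 by norm_num)] with y hy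
    exact (hd y hy).deriv
  have hdd : deriv (deriv f) 0 = b + 1 - 2 * c := by
    rw [he.deriv_eq]
    have h1 : HasDerivAt (fun y : ℝ => (1 + y) ^ (-(b + 1))) (-(b + 1)) (0 : ℝ) := by
      have h := Real.hasDerivAt_rpow_const (x := 1 + 0) (p := -(b + 1)) (Or.inl (by norm_num))
      have := HasDerivAt.comp_const_add (1 : ℝ) (0 : ℝ) h
      simpa using this
    have h2 : HasDerivAt (fun y : ℝ => 1 - 2 * c * y) (-(2 * c)) (0 : ℝ) := by
      have := ((hasDerivAt_id (0 : ℝ)).const_mul (2 * c)).const_sub 1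
      simpa using this
    have := (h2.sub h1).deriv
    rw [show (fun y : ℝ => 1 - 2 * c * y - (1 + y) ^ (-(b + 1))) =
      (fun y : ℝ => 1 - 2 * c * y) - fun y : ℝ => (1 + y) ^ (-(b + 1)) from rfl, this]
    ring
  have hmin := isLocalMin_of_deriv_deriv_pos (f := f) (x₀ := 0) (by rw [hdd]; linarith)
    (by rw [(hd 0 (by norm_num)).deriv]; simp) (hd 0 (by norm_num)).continuousAt
  obtain ⟨ε, hε, h⟩ := Metric.eventually_nhds_iff.1 hmin
  refine ⟨min ε (1 / 2), lt_min hε (by norm_num), lt_of_le_of_lt (min_le_right _ _) (by norm_num),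
    fun y hy => ?_⟩
  have := h (y := y) (by rw [Real.dist_eq, sub_zero]; exact lt_of_lt_of_le hy (min_le_left _ _))
  simp only [f] at this
  simp at this
  linarith

lemma one_d_sum {θ : ℝ} (h0 : 0 < θ) (h1 : θ ≤ 1) (N : ℕ) :
    ∑ k ∈ Finset.range N, (1 + (k : ℝ)) ^ (θ - 1) ≤ (N : ℝ) ^ θ / θ := by
  induction N with
  | zero => simp [h0.ne']
  | succ k ih =>
    rw [Finset.sum_range_succ]
    have hk : (0 : ℝ) < 1 + k := by positivity
    have hB := rpow_one_add_le_one_add_mul_self (s := -(1 / (1 + (k : ℝ)))) (p := θ)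
      (by
        have : 1 / (1 + (k : ℝ)) ≤ 1 := by rw [div_le_one hk]; linarith [Nat.cast_nonneg (α := ℝ) k]
        linarith) h0.le h1
    have e : (k : ℝ) = (1 + k) * (1 + -(1 / (1 + (k : ℝ)))) := by field_simp; ring
    have h3 : (k : ℝ) ^ θ ≤ (1 + (k : ℝ)) ^ θ - θ * (1 + (k : ℝ)) ^ (θ - 1) := by
      have hnn : 0 ≤ 1 + -(1 / (1 + (k : ℝ))) := by
        have : 1 / (1 + (k : ℝ)) ≤ 1 := by rw [div_le_one hk]; linarith [Nat.cast_nonneg (α := ℝ) k]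
        linarith
      have e2 : (k : ℝ) ^ θ = (1 + (k : ℝ)) ^ θ * (1 + -(1 / (1 + (k : ℝ)))) ^ θ := by
        rw [← Real.mul_rpow hk.le hnn, ← e]
      rw [e2]
      have e3 : (1 + (k : ℝ)) ^ (θ - 1) = (1 + (k : ℝ)) ^ θ / (1 + k) := by
        rw [Real.rpow_sub hk, Real.rpow_one]
      rw [e3]
      have := mul_le_mul_of_nonneg_left hB (Real.rpow_nonneg hk.le θ)
      refine this.trans (le_of_eq ?_)
      field_simp
      ring
    have h4 : (1 + (k : ℝ)) ^ (θ - 1) ≤ ((1 + (k : ℝ)) ^ θ - (k : ℝ) ^ θ) / θ := by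
      rw [le_div_iff₀ h0]; linarith
    push_cast
    rw [sub_div] at h4
    rw [add_comm (k : ℝ) 1]
    linarith

lemma zmod_sum {θ : ℝ} (h0 : 0 < θ) (h1 : θ ≤ 1) (N : ℕ) [NeZero N] :
    ∑ x : ZMod N, (1 + (x.valMinAbs.natAbs : ℝ)) ^ (θ - 1) ≤ 2 * ((N : ℝ) ^ θ / θ) := by
  have hs : ∀ g : ℕ → ℝ, ∑ x : ZMod N, g x.val = ∑ k ∈ Finset.range N, g k := by
    intro g
    obtain ⟨n, rfl⟩ : ∃ n, N = n + 1 := ⟨N - 1, by have := NeZero.pos N; omega⟩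
    rw [← Fin.sum_univ_eq_sum_range]
    rfl
  have hle : ∀ x : ZMod N, (1 + (x.valMinAbs.natAbs : ℝ)) ^ (θ - 1) ≤
      (fun k : ℕ => (1 + (k : ℝ)) ^ (θ - 1) + (1 + ((N - 1 - k : ℕ) : ℝ)) ^ (θ - 1)) x.val := by
    intro x
    have hv := ZMod.val_lt x
    rw [ZMod.valMinAbs_natAbs_eq_min]
    have p1 : 0 ≤ (1 + (x.val : ℝ)) ^ (θ - 1) := by positivity
    have p2 : 0 ≤ (1 + ((N - 1 - x.val : ℕ) : ℝ)) ^ (θ - 1) := by positivity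
    rcases min_choice x.val (N - x.val) with h | h <;> rw [h]
    · simp only; linarith
    · have : (1 + ((N - x.val : ℕ) : ℝ)) ^ (θ - 1) ≤ (1 + ((N - 1 - x.val : ℕ) : ℝ)) ^ (θ - 1) := by
        apply Real.rpow_le_rpow_of_nonpos (by positivity) _ (by linarith)
        have : N - 1 - x.val ≤ N - x.val := by omega
        have : ((N - 1 - x.val : ℕ) : ℝ) ≤ ((N - x.val : ℕ) : ℝ) := by exact_mod_cast this
        linarith
      simp only; linarith
  refine (Finset.sum_le_sum fun x _ => hle x).trans ?_
  rw [hs (fun k : ℕ => (1 + (k : ℝ)) ^ (θ - 1) + (1 + ((N - 1 - k : ℕ) : ℝ)) ^ (θ - 1))]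
  rw [Finset.sum_add_distrib,
    Finset.sum_range_reflect (fun k : ℕ => (1 + (k : ℝ)) ^ (θ - 1)) N]
  linarith [one_d_sum h0 h1 N]

end Analysis

section Lattice

variable {d : ℕ}

noncomputable def latQ (z : Fin d → ℤ) : ℝ := 1 + ∑ i, (z i : ℝ) ^ 2

def latS (z : Fin d → ℤ) : ℕ := ∑ i, (z i).natAbs

noncomputable def latK (d : ℕ) : ℝ := 2 * d + 1

noncomputable def latB (d : ℕ) : ℝ := d / 2 - 3 / 4

noncomputable def latH (B : ℝ) (z : Fin d → ℤ) : ℝ :=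
  radF (latB d) (latQ z) - B * ((latK d)⁻¹) ^ latS z

lemma latB_ne (hd : 1 ≤ d) : latB d ≠ 0 := by
  unfold latB
  intro h
  have : (2 * d : ℝ) = 3 := by linarith
  have : 2 * d = 3 := by exact_mod_cast this
  omega

lemma latB_ge (hd : 1 ≤ d) : -(1 / 4) ≤ latB d := by
  unfold latB
  have : (1 : ℝ) ≤ d := by exact_mod_cast hd
  linarith

lemma latK_ge (hd : 1 ≤ d) : 3 ≤ latK d := by
  unfold latK
  have : (1 : ℝ) ≤ d := by exact_mod_cast hd
  linarith

lemma latQ_ge (z : Fin d → ℤ) (i : Fin d) : 1 + (z i : ℝ) ^ 2 ≤ latQ z := by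
  unfold latQ
  have := Finset.single_le_sum (f := fun i => (z i : ℝ) ^ 2) (fun i _ => sq_nonneg _)
    (Finset.mem_univ i)
  linarith

lemma latQ_ge_one (z : Fin d → ℤ) : 1 ≤ latQ z := by
  unfold latQ
  have : 0 ≤ ∑ i, (z i : ℝ) ^ 2 := Finset.sum_nonneg fun i _ => sq_nonneg _
  linarith

lemma latQ_update (z : Fin d → ℤ) (i : Fin d) (a : ℤ) :
    latQ (Function.update z i a) = latQ z - (z i : ℝ) ^ 2 + (a : ℝ) ^ 2 := by
  unfold latQ
  rw [← Finset.add_sum_erase _ _ (Finset.mem_univ i),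
    ← Finset.add_sum_erase Finset.univ (fun i => (z i : ℝ) ^ 2) (Finset.mem_univ i)]
  rw [Finset.sum_congr rfl (g := fun j => (z j : ℝ) ^ 2)]
  · simp; ring
  · intro j hj
    rw [Function.update_of_ne (Finset.ne_of_mem_erase hj)]

lemma latS_update (z : Fin d → ℤ) (i : Fin d) (a : ℤ) :
    latS (Function.update z i a) + (z i).natAbs = latS z + a.natAbs := by
  unfold latS
  rw [← Finset.add_sum_erase _ _ (Finset.mem_univ i),
    ← Finset.add_sum_erase Finset.univ (fun i => (z i).natAbs) (Finset.mem_univ i)]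
  rw [Finset.sum_congr rfl (g := fun j => (z j).natAbs)]
  · simp; ring
  · intro j hj
    rw [Function.update_of_ne (Finset.ne_of_mem_erase hj)]

lemma natAbs_sq_cast (a : ℤ) : ((a.natAbs : ℝ)) ^ 2 = (a : ℝ) ^ 2 := by
  have := Int.natAbs_sq a
  have h : (((a.natAbs : ℤ) ^ 2 : ℤ) : ℝ) = ((a ^ 2 : ℤ) : ℝ) := by rw [this]
  push_cast at h
  simpa using h

lemma latQ_mono {z z' : Fin d → ℤ} (h : ∀ j, (z j).natAbs ≤ (z' j).natAbs) :
    latQ z ≤ latQ z' := by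
  unfold latQ
  have : ∑ i, (z i : ℝ) ^ 2 ≤ ∑ i, (z' i : ℝ) ^ 2 := by
    refine Finset.sum_le_sum fun j _ => ?_
    rw [← natAbs_sq_cast, ← natAbs_sq_cast]
    have : ((z j).natAbs : ℝ) ≤ (z' j).natAbs := by exact_mod_cast h j
    gcongr
  linarith

lemma latH_mono (hd : 1 ≤ d) {B : ℝ} (hB : 0 ≤ B) {z z' : Fin d → ℤ}
    (h : ∀ j, (z j).natAbs ≤ (z' j).natAbs) : latH B z ≤ latH B z' := by
  unfold latH
  have h1 := radF_mono (b := latB d) (by linarith [latQ_ge_one z]) (latQ_mono h) (latB_ne hd)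
  have h2 : latS z ≤ latS z' := Finset.sum_le_sum fun j _ => h j
  have hK := latK_ge hd
  have h3 : ((latK d)⁻¹) ^ latS z' ≤ ((latK d)⁻¹) ^ latS z :=
    pow_le_pow_of_le_one (by positivity) (inv_le_one_of_one_le₀ (by linarith)) h2
  have := mul_le_mul_of_nonneg_left h3 hB
  linarith

lemma one_add_two_abs_le {x Q : ℝ} (h : 1 + x ^ 2 ≤ Q) : 1 + 2 * |x| ≤ 3 * Q ^ (1 / 2 : ℝ) := by
  rw [← Real.sqrt_eq_rpow]
  have h1 : |x| ≤ √Q := Real.abs_le_sqrt (by linarith)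
  have h2 : 1 ≤ √Q := Real.one_le_sqrt.2 (by nlinarith [sq_nonneg x])
  linarith

lemma exp_drift (hd : 1 ≤ d) (z : Fin d → ℤ) (hz : z ≠ 0) :
    ((latK d)⁻¹) ^ latS z ≤
    ∑ i, (((latK d)⁻¹) ^ latS (Function.update z i (z i + 1))
      + ((latK d)⁻¹) ^ latS (Function.update z i (z i - 1)) - 2 * ((latK d)⁻¹) ^ latS z) := by
  have hK := latK_ge hd
  have hK0 : 0 < (latK d)⁻¹ := by positivity
  obtain ⟨i0, hi0⟩ := Function.ne_iff.1 hz
  have hi0 : z i0 ≠ 0 := hi0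
  set T := ((latK d)⁻¹) ^ latS z with hT
  have hlow : ∀ i, (if i = i0 then latK d * T else 0) - 2 * T ≤
      ((latK d)⁻¹) ^ latS (Function.update z i (z i + 1))
      + ((latK d)⁻¹) ^ latS (Function.update z i (z i - 1)) - 2 * T := by
    intro i
    have p1 : 0 ≤ ((latK d)⁻¹) ^ latS (Function.update z i (z i + 1)) := by positivity
    have p2 : 0 ≤ ((latK d)⁻¹) ^ latS (Function.update z i (z i - 1)) := by positivity
    split_ifs with h
    · subst h
      have hk : ∀ m : ℕ, latS z = m + 1 → ((latK d)⁻¹) ^ m = latK d * T := by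
        intro m hm
        rw [hT, hm, pow_succ]
        field_simp
      have s1 := latS_update z i (z i + 1)
      have s2 := latS_update z i (z i - 1)
      rcases lt_or_gt_of_ne hi0 with h | h
      · have := hk (latS (Function.update z i (z i + 1))) (by omega)
        linarith
      · have := hk (latS (Function.update z i (z i - 1))) (by omega)
        linarith
    · linarith
  refine le_trans ?_ (Finset.sum_le_sum fun i _ => hlow i)
  rw [Finset.sum_sub_distrib]
  simp
  unfold latK
  apply le_of_eq
  ring

lemma rad_drift_crude (hd : 1 ≤ d) (z : Fin d → ℤ) :
    ∑ i, (radF (latB d) (latQ (Function.update z i (z i + 1)))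
      + radF (latB d) (latQ (Function.update z i (z i - 1))) - 2 * radF (latB d) (latQ z))
      ≤ 6 * d := by
  have hQ := latQ_ge_one z
  have hb := latB_ge hd
  have key : ∀ i (Q' : ℝ), 1 ≤ Q' → Q' - latQ z ≤ 1 + 2 * |(z i : ℝ)| →
      radF (latB d) Q' - radF (latB d) (latQ z) ≤ 3 := by
    intro i Q' hQ' h
    rcases le_total Q' (latQ z) with h1 | h1
    · have := radF_mono (b := latB d) (by linarith) h1 (latB_ne hd)
      linarith
    · have h2 := radF_sub_le (b := latB d) (latB_ne hd) (by linarith) (by linarith) h1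
      have h3 : latQ z ^ (-(latB d + 1)) ≤ latQ z ^ (-(1 / 2) : ℝ) :=
        Real.rpow_le_rpow_of_exponent_le hQ (by linarith)
      have h4 := one_add_two_abs_le (latQ_ge z i)
      have h5 : latQ z ^ (-(latB d + 1)) * (Q' - latQ z)
          ≤ latQ z ^ (-(1 / 2) : ℝ) * (3 * latQ z ^ (1 / 2 : ℝ)) :=
        mul_le_mul h3 (by linarith) (by linarith) (by positivity)
      have h6 : latQ z ^ (-(1 / 2) : ℝ) * latQ z ^ (1 / 2 : ℝ) = 1 := by
        rw [← Real.rpow_add (by linarith)]; simp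
      nlinarith
  have : ∀ i, radF (latB d) (latQ (Function.update z i (z i + 1)))
      + radF (latB d) (latQ (Function.update z i (z i - 1))) - 2 * radF (latB d) (latQ z) ≤ 6 := by
    intro i
    have a1 := le_abs_self (z i : ℝ)
    have a2 := neg_abs_le (z i : ℝ)
    have k1 := key i (latQ (Function.update z i (z i + 1))) (latQ_ge_one _)
      (by rw [latQ_update]; push_cast; nlinarith)
    have k2 := key i (latQ (Function.update z i (z i - 1))) (latQ_ge_one _)
      (by rw [latQ_update]; push_cast; nlinarith)
    linarith
  refine (Finset.sum_le_sum fun i _ => this i).trans ?_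
  simp; linarith

lemma rad_drift_far (hd : 1 ≤ d) : ∃ Q0 : ℝ, ∀ z : Fin d → ℤ, Q0 ≤ latQ z →
    ∑ i, (radF (latB d) (latQ (Function.update z i (z i + 1)))
      + radF (latB d) (latQ (Function.update z i (z i - 1))) - 2 * radF (latB d) (latQ z))
      ≤ -(1 / 4) * latQ z ^ (-(latB d + 1)) := by
  set b := latB d with hbdef
  have hb := latB_ge hd
  set c : ℝ := (b + 1) / 2 - 1 / 16 with hc
  have hcpos : 0 < c := by linarith
  obtain ⟨δ, hδ, hδ1, hq⟩ := radF_quadratic (b := b) (c := c) (latB_ne hd) (by linarith)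
  refine ⟨max (9 / δ ^ 2 + 1) (24 * c), fun z hz => ?_⟩
  have hQ := latQ_ge_one z
  set Q := latQ z with hQdef
  have hQ1 : 9 / δ ^ 2 < Q := by have := (le_max_left _ _).trans hz; linarith
  have hQ2 : 24 * c ≤ Q := (le_max_right _ _).trans hz
  have hQ0 : 0 < Q := by linarith
  have key : ∀ i (x : ℝ), |x| = |(z i : ℝ)| →
      radF b (Q + 2 * x + 1) - radF b Q
        ≤ Q ^ (-b) * ((1 + 2 * x) / Q - c * ((1 + 2 * x) / Q) ^ 2) := by
    intro i x hx
    have h4 := one_add_two_abs_le (latQ_ge z i)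
    rw [← Real.sqrt_eq_rpow, ← hQdef] at h4
    have hs : √Q * √Q = Q := Real.mul_self_sqrt hQ0.le
    have hs0 : 0 < √Q := Real.sqrt_pos.2 hQ0
    have hs1 : 3 < δ * √Q := by
      rw [div_lt_iff₀ (by positivity)] at hQ1
      by_contra hcon
      push Not at hcon
      have : (δ * √Q) ^ 2 ≤ 3 ^ 2 := by gcongr
      nlinarith
    have hy : |(1 + 2 * x) / Q| < δ := by
      rw [abs_div, abs_of_pos hQ0, div_lt_iff₀ hQ0]
      have : |1 + 2 * x| ≤ 1 + 2 * |x| := by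
        have := abs_add_le 1 (2 * x)
        rw [abs_mul] at this
        simpa using this
      rw [hx] at this
      nlinarith
    have h5 := hq _ hy
    have h6 := radF_scale (b := b) hQ0 (y := (1 + 2 * x) / Q)
      (by have := (abs_lt.1 hy).1; linarith)
    have e : Q * (1 + (1 + 2 * x) / Q) = Q + 2 * x + 1 := by field_simp; ring
    rw [e] at h6
    rw [h6]
    exact mul_le_mul_of_nonneg_left h5 (by positivity)
  have key2 : ∀ i, radF b (latQ (Function.update z i (z i + 1)))
      + radF b (latQ (Function.update z i (z i - 1))) - 2 * radF b Q
      ≤ Q ^ (-b) * (2 / Q - c * (2 + 8 * (z i : ℝ) ^ 2) / Q ^ 2) := by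
    intro i
    have k1 := key i (z i) rfl
    have k2 := key i (-(z i)) (abs_neg _)
    have e1 : latQ (Function.update z i (z i + 1)) = Q + 2 * (z i : ℝ) + 1 := by
      rw [latQ_update]; push_cast; ring
    have e2 : latQ (Function.update z i (z i - 1)) = Q + 2 * (-(z i : ℝ)) + 1 := by
      rw [latQ_update]; push_cast; ring
    rw [e1, e2]
    have e3 : Q ^ (-b) * ((1 + 2 * (z i : ℝ)) / Q - c * ((1 + 2 * (z i : ℝ)) / Q) ^ 2)
      + Q ^ (-b) * ((1 + 2 * (-(z i : ℝ))) / Q - c * ((1 + 2 * (-(z i : ℝ))) / Q) ^ 2)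
      = Q ^ (-b) * (2 / Q - c * (2 + 8 * (z i : ℝ) ^ 2) / Q ^ 2) := by
      field_simp; ring
    linarith
  refine (Finset.sum_le_sum fun i _ => key2 i).trans ?_
  rw [← Finset.mul_sum, Finset.sum_sub_distrib, ← Finset.sum_div, ← Finset.sum_div, ← Finset.mul_sum,
    Finset.sum_add_distrib, ← Finset.mul_sum]
  have e4 : ∑ i, (z i : ℝ) ^ 2 = Q - 1 := by rw [hQdef]; unfold latQ; ring
  rw [e4]
  have e5 : Q ^ (-(b + 1)) = Q ^ (-b) * (1 / Q) := by
    rw [show -(b + 1) = -b - 1 by ring, Real.rpow_sub hQ0, Real.rpow_one]; ring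
  rw [e5]
  have hfin : (∑ i : Fin d, (2 : ℝ)) / Q - c * (∑ i : Fin d, (2 : ℝ) + 8 * (Q - 1)) / Q ^ 2
      ≤ -(1 / 4) * (1 / Q) := by
    simp only [Finset.sum_const, Finset.card_univ, Fintype.card_fin, nsmul_eq_mul]
    have hd1 : (1 : ℝ) ≤ d := by exact_mod_cast hd
    have h8 : 8 * c = 2 * d + 1 / 2 := by rw [hc, hbdef]; unfold latB; ring
    have e6 : (d : ℝ) * 2 / Q - c * (d * 2 + 8 * (Q - 1)) / Q ^ 2 - -(1 / 4) * (1 / Q)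
      = (2 * d * Q - c * (d * 2 + 8 * (Q - 1)) + Q / 4) / Q ^ 2 := by field_simp; ring
    have : (2 * d * Q - c * (d * 2 + 8 * (Q - 1)) + Q / 4) / Q ^ 2 ≤ 0 := by
      apply div_nonpos_of_nonpos_of_nonneg _ (by positivity)
      have : 2 * d * Q - c * (d * 2 + 8 * (Q - 1)) + Q / 4
        = -(Q / 4) + c * (8 - 2 * d) + (2 * d + 1 / 2 - 8 * c) * Q := by ring
      rw [this, h8]
      nlinarith
    linarith
  have := mul_le_mul_of_nonneg_left hfin (show 0 ≤ Q ^ (-b) by positivity)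
  linarith

lemma latS_le_latQ (z : Fin d → ℤ) : (latS z : ℝ) ≤ latQ z := by
  unfold latS latQ
  push_cast
  have : ∑ i, ((z i).natAbs : ℝ) ≤ ∑ i, (z i : ℝ) ^ 2 := by
    refine Finset.sum_le_sum fun j _ => ?_
    rw [← natAbs_sq_cast]
    have := Nat.le_self_pow (n := 2) (by norm_num) (z j).natAbs
    exact_mod_cast this
  linarith

lemma lat_drift (hd : 1 ≤ d) : ∃ B : ℝ, 0 ≤ B ∧ ∀ z : Fin d → ℤ, z ≠ 0 →
    ∑ i, (latH B (Function.update z i (z i + 1)) + latH B (Function.update z i (z i - 1))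
      - 2 * latH B z) ≤ -(1 / 4) * latQ z ^ (-(latB d + 1)) := by
  obtain ⟨Q0, hQ0⟩ := rad_drift_far hd
  have hK := latK_ge hd
  refine ⟨latK d ^ ⌈Q0⌉₊ * (6 * d + 1), by positivity, fun z hz => ?_⟩
  set B := latK d ^ ⌈Q0⌉₊ * (6 * d + 1) with hB
  have hB0 : 0 ≤ B := by positivity
  have hE := exp_drift hd z hz
  have e : ∑ i, (latH B (Function.update z i (z i + 1)) + latH B (Function.update z i (z i - 1))
      - 2 * latH B z) = ∑ i, (radF (latB d) (latQ (Function.update z i (z i + 1)))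
      + radF (latB d) (latQ (Function.update z i (z i - 1))) - 2 * radF (latB d) (latQ z))
      - B * ∑ i, (((latK d)⁻¹) ^ latS (Function.update z i (z i + 1))
      + ((latK d)⁻¹) ^ latS (Function.update z i (z i - 1)) - 2 * ((latK d)⁻¹) ^ latS z) := by
    rw [Finset.mul_sum, ← Finset.sum_sub_distrib]
    refine Finset.sum_congr rfl fun i _ => ?_
    unfold latH; ring
  rw [e]
  have hBE := mul_le_mul_of_nonneg_left hE hB0
  by_cases h : Q0 ≤ latQ z
  · have h1 := hQ0 z h
    have : 0 ≤ B * ((latK d)⁻¹) ^ latS z := by positivity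
    linarith
  · push Not at h
    have h1 := rad_drift_crude hd z
    have hQ := latQ_ge_one z
    have h2 : latS z ≤ ⌈Q0⌉₊ := by
      have : (latS z : ℝ) ≤ (⌈Q0⌉₊ : ℝ) := (latS_le_latQ z).trans (h.le.trans (Nat.le_ceil _))
      exact_mod_cast this
    have h3 : latK d ^ latS z ≤ latK d ^ ⌈Q0⌉₊ := pow_le_pow_right₀ (by linarith) h2
    have h4 : 6 * (d : ℝ) + 1 ≤ B * ((latK d)⁻¹) ^ latS z := by
      rw [hB, inv_pow, ← div_eq_mul_inv, le_div_iff₀ (by positivity), mul_comm]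
      exact mul_le_mul_of_nonneg_right h3 (by positivity)
    have h5 : latQ z ^ (-(latB d + 1)) ≤ 1 :=
      Real.rpow_le_one_of_one_le_of_nonpos hQ (by linarith [latB_ge hd])
    linarith

end Lattice

section Gradient

variable {d : ℕ}

lemma radF_diff {b q q' : ℝ} (hb : b ≠ 0) (hb1 : -(1 / 4) ≤ b) (hq : 1 ≤ q) (h : q ≤ q')
    (h3 : q' - q ≤ 3 * q ^ (1 / 2 : ℝ)) :
    radF b q' - radF b q ≤ 3 * 4 ^ (b + 1 / 2) * q' ^ (-(b + 1 / 2)) := by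
  have hq0 : 0 < q := by linarith
  have h1 := radF_sub_le hb (by linarith) hq0 h
  have h2 : q ^ (-(b + 1)) * (q' - q) ≤ q ^ (-(b + 1)) * (3 * q ^ (1 / 2 : ℝ)) :=
    mul_le_mul_of_nonneg_left h3 (by positivity)
  have e : q ^ (-(b + 1)) * (3 * q ^ (1 / 2 : ℝ)) = 3 * q ^ (-(b + 1 / 2)) := by
    rw [show -(b + 1 / 2) = -(b + 1) + 1 / 2 by ring, Real.rpow_add hq0]; ring
  have h4 : q' ≤ 4 * q := by
    have : q ^ (1 / 2 : ℝ) ≤ q := by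
      calc q ^ (1 / 2 : ℝ) ≤ q ^ (1 : ℝ) := Real.rpow_le_rpow_of_exponent_le hq (by norm_num)
        _ = q := Real.rpow_one q
    linarith
  have h5 : q ^ (-(b + 1 / 2)) ≤ 4 ^ (b + 1 / 2) * q' ^ (-(b + 1 / 2)) := by
    have : (4 * q) ^ (-(b + 1 / 2)) ≤ q' ^ (-(b + 1 / 2)) :=
      Real.rpow_le_rpow_of_nonpos (by linarith) h4 (by linarith)
    rw [Real.mul_rpow (by norm_num) hq0.le] at this
    have h6 := mul_le_mul_of_nonneg_left this (show (0 : ℝ) ≤ 4 ^ (b + 1 / 2) by positivity)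
    rw [← mul_assoc, ← Real.rpow_add (by norm_num)] at h6
    simpa using h6
  linarith

lemma radF_diff_abs {b q q' : ℝ} (hb : b ≠ 0) (hb1 : -(1 / 4) ≤ b) (hq : 1 ≤ q) (hq' : 1 ≤ q')
    (h3 : |q' - q| ≤ 3 * (min q q') ^ (1 / 2 : ℝ)) :
    |radF b q' - radF b q| ≤ 3 * 4 ^ (b + 1 / 2) * q ^ (-(b + 1 / 2)) := by
  rcases le_total q q' with h | h
  · rw [abs_of_nonneg (by linarith [radF_mono (b := b) (by linarith) h hb])]
    rw [abs_of_nonneg (by linarith), min_eq_left h] at h3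
    have h1 := radF_sub_le hb (by linarith) (show 0 < q by linarith) h
    have h2 : q ^ (-(b + 1)) * (q' - q) ≤ q ^ (-(b + 1)) * (3 * q ^ (1 / 2 : ℝ)) :=
      mul_le_mul_of_nonneg_left h3 (by positivity)
    have e : q ^ (-(b + 1)) * (3 * q ^ (1 / 2 : ℝ)) = 3 * q ^ (-(b + 1 / 2)) := by
      rw [show -(b + 1 / 2) = -(b + 1) + 1 / 2 by ring, Real.rpow_add (by linarith)]; ring
    have h6 : (1 : ℝ) ≤ 4 ^ (b + 1 / 2) := Real.one_le_rpow (by norm_num) (by linarith)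
    have h7 : 0 ≤ q ^ (-(b + 1 / 2)) := by positivity
    nlinarith
  · rw [abs_of_nonpos (by linarith [radF_mono (b := b) (by linarith) h hb])]
    rw [abs_of_nonpos (by linarith), min_eq_right h] at h3
    have := radF_diff hb hb1 hq' h (by linarith)
    linarith

noncomputable def latW (z : Fin d → ℤ) : ℝ :=
  ∏ j, (1 + ((z j).natAbs : ℝ)) ^ ((1 / (2 * d) : ℝ) - 1)

lemma latQ_pow_le (hd : 1 ≤ d) (z : Fin d → ℤ) :
    latQ z ^ (-(latB d + 1 / 2)) ≤ 2 ^ (latB d + 1 / 2) * latW z := by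
  have hQ := latQ_ge_one z
  have hd1 : (1 : ℝ) ≤ d := by exact_mod_cast hd
  have hd0 : (d : ℝ) ≠ 0 := by positivity
  have hb := latB_ge hd
  set e := latB d + 1 / 2 with he
  have hpos : 0 ≤ e / d := by apply div_nonneg <;> linarith
  have hprod : ∀ a : ℝ, 0 ≤ a → ∀ r : ℝ, a ^ r = ∏ _j : Fin d, a ^ (r / d) := by
    intro a ha r
    rw [Finset.prod_const, Finset.card_univ, Fintype.card_fin, ← Real.rpow_natCast,
      ← Real.rpow_mul ha]
    congr 1; field_simp
  rw [hprod (latQ z) (by linarith), hprod 2 (by norm_num), latW, ← Finset.prod_mul_distrib]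
  refine Finset.prod_le_prod (fun j _ => by positivity) fun j _ => ?_
  have h1 := latQ_ge z j
  rw [← natAbs_sq_cast] at h1
  set a : ℝ := ((z j).natAbs : ℝ)
  have ha : 0 ≤ a := Nat.cast_nonneg _
  have h2 : (1 + a) ^ 2 / 2 ≤ latQ z := by nlinarith [sq_nonneg (1 - a)]
  have h3 : latQ z ^ (-e / d) ≤ ((1 + a) ^ 2 / 2) ^ (-e / d) :=
    Real.rpow_le_rpow_of_nonpos (by positivity) h2 (by rw [neg_div]; linarith)
  refine h3.trans (le_of_eq ?_)
  rw [Real.div_rpow (by positivity) (by norm_num), neg_div, Real.rpow_neg (by norm_num : (0:ℝ) ≤ 2),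
    div_inv_eq_mul, mul_comm]
  congr 1
  rw [← Real.rpow_natCast, ← Real.rpow_mul (by positivity)]
  congr 1
  rw [he]; unfold latB
  field_simp
  push_cast
  ring

lemma exp_le_latW (hd : 1 ≤ d) (z : Fin d → ℤ) : ((latK d)⁻¹) ^ latS z ≤ latW z := by
  have hK := latK_ge hd
  have hd1 : (1 : ℝ) ≤ d := by exact_mod_cast hd
  unfold latS latW
  rw [← Finset.prod_pow_eq_pow_sum]
  refine Finset.prod_le_prod (fun j _ => by positivity) fun j _ => ?_
  set a := (z j).natAbs
  have h1 : (1 : ℝ) + a ≤ latK d ^ a := by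
    have h := one_add_mul_le_pow (a := latK d - 1) (by linarith) a
    have : (0 : ℝ) ≤ a := Nat.cast_nonneg _
    rw [show 1 + (latK d - 1) = latK d by ring] at h
    nlinarith
  have h2 : (1 + (a : ℝ)) ^ (-1 : ℝ) ≤ (1 + (a : ℝ)) ^ ((1 / (2 * d) : ℝ) - 1) := by
    apply Real.rpow_le_rpow_of_exponent_le
    · linarith [Nat.cast_nonneg (α := ℝ) a]
    · have : 0 ≤ (1 / (2 * d) : ℝ) := by positivity
      linarith
  refine le_trans ?_ h2
  rw [Real.rpow_neg_one, inv_pow]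
  exact inv_anti₀ (by positivity) h1

noncomputable def gradC (d : ℕ) (B : ℝ) : ℝ :=
  3 * 4 ^ (latB d + 1 / 2) * 2 ^ (latB d + 1 / 2) + B * (latK d + 1)

lemma lat_grad (hd : 1 ≤ d) {B : ℝ} (hB : 0 ≤ B) (z : Fin d → ℤ) (i : Fin d) (a : ℤ)
    (h1 : a.natAbs ≤ (z i).natAbs + 1) (h2 : (z i).natAbs ≤ a.natAbs + 1) :
    |latH B (Function.update z i a) - latH B z| ≤ gradC d B * latW z := by
  have hK := latK_ge hd
  have hrad : |radF (latB d) (latQ (Function.update z i a)) - radF (latB d) (latQ z)|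
      ≤ 3 * 4 ^ (latB d + 1 / 2) * latQ z ^ (-(latB d + 1 / 2)) := by
    refine radF_diff_abs (latB_ne hd) (latB_ge hd) (latQ_ge_one _) (latQ_ge_one _) ?_
    have e1 := latQ_update z i a
    have g1 := latQ_ge z i
    have g2 := latQ_ge (Function.update z i a) i
    rw [Function.update_self] at g2
    rw [← natAbs_sq_cast, ← natAbs_sq_cast] at e1
    have k1 : (a.natAbs : ℝ) ≤ (z i).natAbs + 1 := by exact_mod_cast h1
    have k2 : ((z i).natAbs : ℝ) ≤ a.natAbs + 1 := by exact_mod_cast h2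
    have n1 : (0 : ℝ) ≤ a.natAbs := Nat.cast_nonneg _
    have n2 : (0 : ℝ) ≤ (z i).natAbs := Nat.cast_nonneg _
    have f1 := one_add_two_abs_le g1
    have f2 := one_add_two_abs_le g2
    have c1 : |(z i : ℝ)| = ((z i).natAbs : ℝ) := by simp
    have c2 : |(a : ℝ)| = (a.natAbs : ℝ) := by simp
    rw [c1] at f1
    rw [c2] at f2
    rcases le_total (latQ z) (latQ (Function.update z i a)) with h | h
    · rw [min_eq_left h, abs_of_nonneg (by linarith)]
      nlinarith
    · rw [min_eq_right h, abs_of_nonpos (by linarith)]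
      nlinarith
  have hrad2 : |radF (latB d) (latQ (Function.update z i a)) - radF (latB d) (latQ z)|
      ≤ 3 * 4 ^ (latB d + 1 / 2) * 2 ^ (latB d + 1 / 2) * latW z := by
    refine hrad.trans ?_
    rw [mul_assoc _ _ (latW z)]
    exact mul_le_mul_of_nonneg_left (latQ_pow_le hd z) (by positivity)
  set T := ((latK d)⁻¹) ^ latS z with hT
  set T' := ((latK d)⁻¹) ^ latS (Function.update z i a) with hT'
  have hT0 : 0 ≤ T := by positivity
  have hT0' : 0 ≤ T' := by positivity
  have hTT : T' ≤ latK d * T := by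
    have hs := latS_update z i a
    have : latS z ≤ latS (Function.update z i a) + 1 := by omega
    have h3 : ((latK d)⁻¹) ^ (latS (Function.update z i a) + 1) ≤ T :=
      pow_le_pow_of_le_one (by positivity) (inv_le_one_of_one_le₀ (by linarith)) this
    rw [pow_succ, ← hT', ← div_eq_mul_inv, div_le_iff₀ (by linarith)] at h3
    linarith
  have hexp : |T' - T| ≤ (latK d + 1) * latW z := by
    have h3 : |T' - T| ≤ (latK d + 1) * T := by
      rw [abs_le]; constructor <;> nlinarith
    exact h3.trans (mul_le_mul_of_nonneg_left (exp_le_latW hd z) (by linarith))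
  have e : latH B (Function.update z i a) - latH B z =
      (radF (latB d) (latQ (Function.update z i a)) - radF (latB d) (latQ z)) - B * (T' - T) := by
    unfold latH; ring
  rw [e]
  refine (abs_sub _ _).trans ?_
  rw [abs_mul, abs_of_nonneg hB]
  have := mul_le_mul_of_nonneg_left hexp hB
  unfold gradC
  linarith

lemma lat_range (hd : 1 ≤ d) {B : ℝ} (hB : 0 ≤ B) (z z' : Fin d → ℤ) :
    latH B z - latH B z' ≤ 4 * latQ z ^ (1 / 4 : ℝ) + B := by
  have hK := latK_ge hd
  have hQ := latQ_ge_one z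
  have h1 : radF (latB d) 1 ≤ radF (latB d) (latQ z') :=
    radF_mono (by norm_num) (latQ_ge_one z') (latB_ne hd)
  have h2 : radF (latB d) (latQ z) - radF (latB d) 1 ≤ 4 * latQ z ^ (1 / 4 : ℝ) := by
    have hQ4 : 1 ≤ latQ z ^ (1 / 4 : ℝ) := Real.one_le_rpow hQ (by norm_num)
    unfold radF
    rw [Real.one_rpow]
    rcases Nat.lt_or_ge 1 d with h | h
    · have h2 : (2 : ℝ) ≤ d := by exact_mod_cast h
      have hb : 1 / 4 ≤ latB d := by unfold latB; linarith
      have h3 : 0 ≤ latQ z ^ (-latB d) / latB d := by positivity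
      have h4 : 1 / latB d ≤ 4 := by
        rw [div_le_iff₀ (by linarith)]; linarith
      have e : -latQ z ^ (-latB d) / latB d - -1 / latB d
        = 1 / latB d - latQ z ^ (-latB d) / latB d := by ring
      linarith
    · have hd1 : d = 1 := by omega
      subst hd1
      have e : latB 1 = -(1 / 4) := by unfold latB; norm_num
      rw [e]
      norm_num
      linarith
  have p1 : 0 ≤ B * ((latK d)⁻¹) ^ latS z := by positivity
  have p2 : B * ((latK d)⁻¹) ^ latS z' ≤ B := by
    have : ((latK d)⁻¹) ^ latS z' ≤ 1 :=
      pow_le_one₀ (by positivity) (inv_le_one_of_one_le₀ (by linarith))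
    nlinarith
  unfold latH
  linarith

end Gradient

section Torus

variable {d N : ℕ}

/-- Centered integer coordinates of `x` relative to `w`. -/
def cen (w x : Fin d → ZMod N) : Fin d → ℤ := fun j => (x j - w j).valMinAbs

lemma torus_neighbor_sum (hN : 3 ≤ N) [NeZero N] (G : SimpleGraph (Fin d → ZMod N))
    [DecidableRel G.Adj] (hG : ∀ x y, G.Adj x y ↔ TorusAdj d N x y) (u : Fin d → ZMod N)
    (g : (Fin d → ZMod N) → ℝ) :
    ∑ v ∈ G.neighborFinset u, g v
      = ∑ i, (g (Function.update u i (u i + 1)) + g (Function.update u i (u i - 1))) := by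
  haveI : Fact (2 < N) := ⟨hN⟩
  haveI : Fact (1 < N) := ⟨by omega⟩
  have h10 : (1 : ZMod N) ≠ 0 := one_ne_zero
  have h11 : (-1 : ZMod N) ≠ 1 := ZMod.neg_one_ne_one
  let φ : Fin d × Bool → (Fin d → ZMod N) := fun p =>
    Function.update u p.1 (if p.2 then u p.1 + 1 else u p.1 - 1)
  have hne : ∀ p : Fin d × Bool, (if p.2 then u p.1 + 1 else u p.1 - 1) ≠ u p.1 := by
    rintro ⟨i, b⟩
    cases b <;> simp [h10]
  have hinj : Function.Injective φ := by
    rintro ⟨i, b⟩ ⟨j, c⟩ h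
    have hij : i = j := by
      by_contra hij
      have := congrFun h i
      simp only [φ] at this
      rw [Function.update_self, Function.update_of_ne hij] at this
      exact hne (i, b) this
    subst hij
    have := congrFun h i
    simp only [φ, Function.update_self] at this
    have hbc : b = c := by
      cases b <;> cases c <;> simp at this ⊢
      · rw [sub_eq_add_neg] at this
        exact h11 (add_left_cancel this)
      · rw [sub_eq_add_neg] at this
        exact h11 (add_left_cancel this).symm
    rw [hbc]
  have himg : G.neighborFinset u = Finset.univ.image φ := by
    ext v
    rw [SimpleGraph.mem_neighborFinset, hG]
    simp only [Finset.mem_image, Finset.mem_univ, true_and, Prod.exists]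
    constructor
    · rintro ⟨i, h | h, hj⟩
      · refine ⟨i, false, ?_⟩
        funext j
        by_cases hji : j = i
        · subst hji; simp [φ, h]
        · simp [φ, hji, hj j hji]
      · refine ⟨i, true, ?_⟩
        funext j
        by_cases hji : j = i
        · subst hji; simp [φ, h]
        · simp [φ, hji, hj j hji]
    · rintro ⟨i, b, rfl⟩
      refine ⟨i, ?_, fun j hji => by simp [φ, hji]⟩
      cases b
      · left; simp [φ]
      · right; simp [φ]
  rw [himg, Finset.sum_image (fun _ _ _ _ h => hinj h), Fintype.sum_prod_type]
  refine Finset.sum_congr rfl fun i _ => ?_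
  simp [φ]

lemma cen_update (w u : Fin d → ZMod N) (i : Fin d) (a : ZMod N) :
    cen w (Function.update u i a) = Function.update (cen w u) i (a - w i).valMinAbs := by
  funext j
  by_cases h : j = i
  · subst h; simp [cen]
  · simp [cen, h]

lemma vma_add [NeZero N] (x : ZMod N) (k : ℤ) :
    (x + k).valMinAbs.natAbs ≤ (x.valMinAbs + k).natAbs := by
  apply ZMod.natAbs_min_of_le_div_two N
  · simp
  · exact ZMod.natAbs_valMinAbs_le _

lemma cen_ne_zero [NeZero N] {w u : Fin d → ZMod N} (h : u ≠ w) : cen w u ≠ 0 := by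
  intro hc
  apply h
  funext j
  have := congrFun hc j
  simp only [cen, Pi.zero_apply, ZMod.valMinAbs_eq_zero] at this
  exact sub_eq_zero.1 this

lemma latQ_cen_le (hd : 1 ≤ d) (hN : 3 ≤ N) [NeZero N] (w u : Fin d → ZMod N) :
    latQ (cen w u) ≤ 2 * d * (N : ℝ) ^ 2 := by
  unfold latQ
  have h1 : ∑ i, (cen w u i : ℝ) ^ 2 ≤ ∑ _i : Fin d, (N : ℝ) ^ 2 := by
    refine Finset.sum_le_sum fun j _ => ?_
    rw [← natAbs_sq_cast]
    have h := ZMod.natAbs_valMinAbs_le (u j - w j)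
    have h2 : (cen w u j).natAbs ≤ N := by
      unfold cen; omega
    have : ((cen w u j).natAbs : ℝ) ≤ N := by exact_mod_cast h2
    gcongr
  simp at h1
  have hd1 : (1 : ℝ) ≤ d := by exact_mod_cast hd
  have hN1 : (3 : ℝ) ≤ N := by exact_mod_cast hN
  nlinarith

lemma torus_drift (hd : 1 ≤ d) (hN : 3 ≤ N) [NeZero N] (G : SimpleGraph (Fin d → ZMod N))
    [DecidableRel G.Adj] (hG : ∀ x y, G.Adj x y ↔ TorusAdj d N x y) {B : ℝ} (hB : 0 ≤ B)
    (hdr : ∀ z : Fin d → ℤ, z ≠ 0 →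
      ∑ i, (latH B (Function.update z i (z i + 1)) + latH B (Function.update z i (z i - 1))
      - 2 * latH B z) ≤ -(1 / 4) * latQ z ^ (-(latB d + 1)))
    (w u : Fin d → ZMod N) (huw : u ≠ w) :
    ∑ v ∈ G.neighborFinset u, (latH B (cen w v) - latH B (cen w u))
      ≤ -(1 / 4) * (2 * d * (N : ℝ) ^ 2) ^ (-(latB d + 1)) := by
  rw [torus_neighbor_sum hN G hG]
  have h1 : ∀ (i : Fin d) (k : ℤ), latH B (cen w (Function.update u i (u i + k)))
      ≤ latH B (Function.update (cen w u) i (cen w u i + k)) := by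
    intro i k
    apply latH_mono hd hB
    intro j
    rw [cen_update]
    by_cases h : j = i
    · subst h
      rw [Function.update_self, Function.update_self]
      have := vma_add (u j - w j) k
      rw [show u j + (k : ZMod N) - w j = u j - w j + k by ring]
      exact this
    · rw [Function.update_of_ne h, Function.update_of_ne h]
  have h2 := hdr (cen w u) (cen_ne_zero huw)
  have h3 : (2 * d * (N : ℝ) ^ 2) ^ (-(latB d + 1)) ≤ latQ (cen w u) ^ (-(latB d + 1)) :=
    Real.rpow_le_rpow_of_nonpos (by linarith [latQ_ge_one (cen w u)]) (latQ_cen_le hd hN w u)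
      (by linarith [latB_ge hd])
  refine le_trans ?_ (h2.trans (by linarith))
  refine Finset.sum_le_sum fun i _ => ?_
  have a1 := h1 i 1
  have a2 := h1 i (-1)
  simp only [Int.cast_one, Int.cast_neg, ← sub_eq_add_neg] at a1 a2
  linarith

lemma torus_W_sum (hd : 1 ≤ d) [NeZero N] (w : Fin d → ZMod N) :
    ∑ u : Fin d → ZMod N, latW (cen w u) ≤ (4 * d) ^ d * (N : ℝ) ^ (1 / 2 : ℝ) := by
  have hd1 : (1 : ℝ) ≤ d := by exact_mod_cast hd
  have e1 : ∑ u : Fin d → ZMod N, latW (cen w u)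
      = ∑ u : Fin d → ZMod N, ∏ j, (1 + ((u j).valMinAbs.natAbs : ℝ)) ^ ((1 / (2 * d) : ℝ) - 1) :=
    Fintype.sum_equiv (Equiv.subRight w) _ _ (fun u => rfl)
  have e2 := Finset.prod_univ_sum (fun _ : Fin d => (Finset.univ : Finset (ZMod N)))
    (fun _ x => (1 + (x.valMinAbs.natAbs : ℝ)) ^ ((1 / (2 * d) : ℝ) - 1))
  rw [Fintype.piFinset_univ] at e2
  rw [e1, ← e2, Finset.prod_const, Finset.card_univ, Fintype.card_fin]
  have hθ : (0 : ℝ) < 1 / (2 * d) := by positivity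
  have h := zmod_sum hθ (by rw [div_le_one (by positivity)]; linarith) N
  have h2 := pow_le_pow_left₀ (Finset.sum_nonneg fun _ _ => by positivity) h d
  refine h2.trans (le_of_eq ?_)
  have e3 : 2 * ((N : ℝ) ^ (1 / (2 * d) : ℝ) / (1 / (2 * d)))
      = (4 * d) * (N : ℝ) ^ (1 / (2 * d) : ℝ) := by field_simp; ring
  rw [e3, mul_pow, ← Real.rpow_natCast ((N : ℝ) ^ (1 / (2 * d) : ℝ)) d,
    ← Real.rpow_mul (Nat.cast_nonneg _)]
  congr 2
  field_simp

lemma torus_TV (hd : 1 ≤ d) (hN : 3 ≤ N) [NeZero N] (G : SimpleGraph (Fin d → ZMod N))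
    [DecidableRel G.Adj] (hG : ∀ x y, G.Adj x y ↔ TorusAdj d N x y) {B : ℝ} (hB : 0 ≤ B)
    (w : Fin d → ZMod N) :
    ∑ u, ∑ v ∈ G.neighborFinset u, |latH B (cen w v) - latH B (cen w u)|
      ≤ 2 * d * gradC d B * ((4 * d) ^ d * (N : ℝ) ^ (1 / 2 : ℝ)) := by
  have hK := latK_ge hd
  have hg : 0 ≤ gradC d B := by unfold gradC; positivity
  refine le_trans ?_ (mul_le_mul_of_nonneg_left (torus_W_sum hd w) (by positivity))
  rw [Finset.mul_sum]
  refine Finset.sum_le_sum fun u _ => ?_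
  rw [torus_neighbor_sum hN G hG u (fun v => |latH B (cen w v) - latH B (cen w u)|)]
  have h1 : ∀ (i : Fin d) (k : ℤ), k.natAbs = 1 →
      |latH B (cen w (Function.update u i (u i + k))) - latH B (cen w u)|
        ≤ gradC d B * latW (cen w u) := by
    intro i k hk
    rw [cen_update, show u i + (k : ZMod N) - w i = u i - w i + k by ring]
    have a1 := vma_add (u i - w i) k
    have a2 := vma_add (u i - w i + (k : ZMod N)) (-k)
    rw [show u i - w i + (k : ZMod N) + ((-k : ℤ) : ZMod N) = u i - w i by push_cast; ring] at a2
    apply lat_grad hd hB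
    · unfold cen; omega
    · unfold cen; omega
  have h2 : ∀ i : Fin d, |latH B (cen w (Function.update u i (u i + 1))) - latH B (cen w u)|
      + |latH B (cen w (Function.update u i (u i - 1))) - latH B (cen w u)|
      ≤ 2 * (gradC d B * latW (cen w u)) := by
    intro i
    have a1 := h1 i 1 rfl
    have a2 := h1 i (-1) rfl
    simp only [Int.cast_one, Int.cast_neg, ← sub_eq_add_neg] at a1 a2
    linarith
  refine (Finset.sum_le_sum fun i _ => h2 i).trans (le_of_eq ?_)
  simp
  ring

lemma torus_degree (hN : 3 ≤ N) [NeZero N] (G : SimpleGraph (Fin d → ZMod N))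
    [DecidableRel G.Adj] (hG : ∀ x y, G.Adj x y ↔ TorusAdj d N x y) (u : Fin d → ZMod N) :
    (G.degree u : ℝ) = 2 * d := by
  have := torus_neighbor_sum hN G hG u (fun _ => 1)
  simp at this
  rw [this]; ring

end Torus

/-- For every fixed `d ≥ 1` there is a constant `C_d` such that for every
`d`-dimensional torus graph on `n = N^d` vertices (`N ≥ 3`), the deterministic edge cover
time satisfies `ẼC(G) ≤ C_d·κ̃·n^{1+1/d}`. -/
theorem detEdgeCover_torus_le (d : ℕ) (hd : 1 ≤ d) :
    ∃ C : ℝ, 0 < C ∧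
      ∀ N : ℕ, 3 ≤ N →
        ∀ [NeZero N],
        ∀ (G : SimpleGraph (Fin d → ZMod N)) [DecidableRel G.Adj],
          (∀ x y, G.Adj x y ↔ TorusAdj d N x y) →
          ∀ (cfg : RotorConfig G) (x0 : Fin d → ZMod N),
            ∃ t : ℕ,
              (t : ℝ) ≤ C * (cfg.kappa : ℝ) *
                (((N ^ d : ℕ) : ℝ) ^ ((1 : ℝ) + 1 / (d : ℝ))) ∧
              cfg.coversEdges x0 t := by
  have hd1 : (1 : ℝ) ≤ d := by exact_mod_cast hd
  obtain ⟨B, hB, hdr⟩ := lat_drift hd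
  have hK := latK_ge hd
  have hg : 0 ≤ gradC d B := by unfold gradC; positivity
  set c1 : ℝ := 8 * d * (2 * d) ^ (latB d + 1) with hc1
  set c2 : ℝ := 2 * d * gradC d B * (4 * d) ^ d with hc2
  set c3 : ℝ := 4 * (2 * d) ^ (1 / 4 : ℝ) + B with hc3
  have hc1p : 0 ≤ c1 := by positivity
  have hc2p : 0 ≤ c2 := by positivity
  have hc3p : 0 ≤ c3 := by positivity
  refine ⟨2 * d + c1 * c2 + c1 * c3 + 1, by positivity, ?_⟩
  intro N hN _ G _ hG cfg x0
  have hN1 : (3 : ℝ) ≤ N := by exact_mod_cast hN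
  have hN0 : (0 : ℝ) < N := by linarith
  have hpow : (((N ^ d : ℕ) : ℝ) ^ ((1 : ℝ) + 1 / (d : ℝ))) = (N : ℝ) ^ (d + 1) := by
    push_cast
    rw [← Real.rpow_natCast, ← Real.rpow_natCast, ← Real.rpow_mul hN0.le]
    congr 1
    push_cast
    field_simp
  rw [hpow]
  have hκ : (1 : ℝ) ≤ cfg.kappa := by
    exact_mod_cast (cfg.quot_pos x0).trans_le (cfg.quot_le x0)
  set κ : ℝ := (cfg.kappa : ℝ) with hκd
  set R : ℝ := (N : ℝ) ^ (d + 1) with hR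
  have hR1 : 1 ≤ R := one_le_pow₀ (by linarith)
  set U : ℝ := (2 * d + c1 * c2 + c1 * c3) * κ * R with hU
  have hU0 : 0 ≤ U := by positivity
  set s : ℝ := (N : ℝ) ^ (1 / 2 : ℝ) with hs
  -- scaling constant
  set A : ℝ := 8 * d * (2 * d * (N : ℝ) ^ 2) ^ (latB d + 1) with hA
  have hAp : 0 ≤ A := by positivity
  have hAs : A * s = c1 * R := by
    rw [hA, hc1, hs, hR, Real.mul_rpow (by positivity) (by positivity),
      ← Real.rpow_natCast (N : ℝ) 2, ← Real.rpow_mul hN0.le]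
    have : (N : ℝ) ^ (d + 1) = (N : ℝ) ^ (((2 : ℕ) : ℝ) * (latB d + 1)) * (N : ℝ) ^ (1 / 2 : ℝ) := by
      rw [← Real.rpow_add hN0, ← Real.rpow_natCast]
      congr 1
      unfold latB
      push_cast
      ring
    rw [this]
    ring
  refine ⟨⌊U⌋₊ + 1, ?_, ?_⟩
  · have h1 := Nat.floor_le hU0
    push_cast
    have : 1 ≤ κ * R := one_le_mul_of_one_le_of_one_le hκ hR1
    rw [hU] at h1 ⊢
    linarith
  · apply cfg.covers_of_visits
    intro w
    by_contra hcon
    push Not at hcon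
    have hmain := cfg.time_le x0 w (fun x => A * latH B (cen w x)) (⌊U⌋₊ + 1) (by
      intro u huw
      have h1 := torus_drift hd hN G hG hB hdr w u huw
      rw [torus_degree hN G hG]
      simp_rw [← mul_sub]
      rw [← Finset.mul_sum]
      refine (mul_le_mul_of_nonneg_left h1 hAp).trans (le_of_eq ?_)
      have e : (2 * d * (N : ℝ) ^ 2) ^ (latB d + 1) * (2 * d * (N : ℝ) ^ 2) ^ (-(latB d + 1)) = 1 := by
        rw [← Real.rpow_add (by positivity)]; simp
      rw [hA]
      linear_combination (-(2 : ℝ) * d) * e) hcon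
    have hdeg : ∑ u, (G.degree u : ℝ) ≤ 2 * d * R := by
      simp_rw [torus_degree hN G hG]
      rw [Finset.sum_const, Finset.card_univ, Fintype.card_fun, ZMod.card, Fintype.card_fin,
        nsmul_eq_mul, mul_comm]
      push_cast
      have : (N : ℝ) ^ d ≤ R := pow_le_pow_right₀ (by linarith) (by omega)
      gcongr
    have hTV : ∑ u, ∑ v ∈ G.neighborFinset u,
        |A * latH B (cen w v) - A * latH B (cen w u)| ≤ c1 * c2 * R := by
      have h1 := mul_le_mul_of_nonneg_left (torus_TV hd hN G hG hB w) hAp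
      simp_rw [← mul_sub, abs_mul, abs_of_nonneg hAp, ← Finset.mul_sum]
      refine h1.trans (le_of_eq ?_)
      rw [hc2]
      linear_combination (2 * d * gradC d B * (4 * d) ^ d) * hAs
    have hrange : A * latH B (cen w x0) - A * latH B (cen w (cfg.pos x0 (⌊U⌋₊ + 1)))
        ≤ c1 * c3 * R := by
      have h1 := lat_range hd hB (cen w x0) (cen w (cfg.pos x0 (⌊U⌋₊ + 1)))
      have h2 : latQ (cen w x0) ^ (1 / 4 : ℝ) ≤ (2 * d * (N : ℝ) ^ 2) ^ (1 / 4 : ℝ) :=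
        Real.rpow_le_rpow (by linarith [latQ_ge_one (cen w x0)]) (latQ_cen_le hd hN w x0)
          (by norm_num)
      have h3 : (2 * d * (N : ℝ) ^ 2) ^ (1 / 4 : ℝ) = (2 * d) ^ (1 / 4 : ℝ) * s := by
        rw [Real.mul_rpow (by positivity) (by positivity), hs,
          ← Real.rpow_natCast (N : ℝ) 2, ← Real.rpow_mul hN0.le]
        norm_num
      have hs1 : 1 ≤ s := Real.one_le_rpow (by linarith) (by norm_num)
      have h4 : latH B (cen w x0) - latH B (cen w (cfg.pos x0 (⌊U⌋₊ + 1))) ≤ c3 * s := by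
        rw [h3] at h2
        rw [hc3]
        nlinarith
      rw [← mul_sub]
      refine (mul_le_mul_of_nonneg_left h4 hAp).trans (le_of_eq ?_)
      linear_combination c3 * hAs
    have hlt := Nat.lt_floor_add_one U
    push_cast at hmain
    have k1 : κ * ∑ u, (G.degree u : ℝ) ≤ κ * (2 * d * R) :=
      mul_le_mul_of_nonneg_left hdeg (by linarith)
    have k2 : κ * ∑ u, ∑ v ∈ G.neighborFinset u,
        |A * latH B (cen w v) - A * latH B (cen w u)| ≤ κ * (c1 * c2 * R) :=
      mul_le_mul_of_nonneg_left hTV (by linarith)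
    have k3 : c1 * c3 * R ≤ κ * (c1 * c3 * R) := le_mul_of_one_le_left (by positivity) hκ
    have k4 : U = κ * (2 * d * R) + κ * (c1 * c2 * R) + κ * (c1 * c3 * R) := by
      rw [hU]; ring
    linarith
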